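/- Assume the transshipment problem is feasible (there exists a positive flow). Under the Physarum dynamics, there exist constants C > 0 and a₁ > 0 such that σ_e(t) ≤ C·e^{−a₁t} for all t ≥ 0 and every arc e ∉ Ĥ, where Ĥ is the set of arcs carried by some minimum-cost positive flow. -/

import Mathlib

open scoped BigOperators

section PhysarumSetup

variable {V E : Type*} [Fintype V] [Fintype E] [DecidableEq V] [DecidableEq E]

/-- Incidence (boundary) matrix of the digraph given by `tail`/`head`:
`+1` if `i` is the tail of `e`, `-1` if `i` is the head of `e`, `0` otherwise. -/
def incMatrix (tail head : E → V) : Matrix V E ℝ :=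
  Matrix.of fun i e => if tail e = i then (1 : ℝ) else if head e = i then -1 else 0

/-- The digraph has no loops. -/
def NoLoops (tail head : E → V) : Prop := ∀ e, tail e ≠ head e

/-- The digraph has no multiple arcs. -/
def NoMultiple (tail head : E → V) : Prop :=
  ∀ e f, tail e = tail f → head e = head f → e = f

/-- Adjacency in the underlying undirected graph. -/
def Adj (tail head : E → V) (i j : V) : Prop :=
  ∃ e, (tail e = i ∧ head e = j) ∨ (tail e = j ∧ head e = i)

/-- The underlying undirected graph is connected. -/
def IsConnectedGraph (tail head : E → V) : Prop :=
  ∀ i j : V, Relation.ReflTransGen (Adj tail head) i j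

/-- `φ` is a flow with source vector `b`: `Bφ = b`. -/
def IsFlow (tail head : E → V) (b : V → ℝ) (φ : E → ℝ) : Prop :=
  (incMatrix tail head).mulVec φ = b

/-- Net supply `b(S)` of a vertex set `S`. -/
def netSupply (b : V → ℝ) (S : Finset V) : ℝ := ∑ i ∈ S, b i

/-- `b*_max = max_{S ⊆ V} |b(S)|`. -/
noncomputable def bstarMax (b : V → ℝ) : ℝ :=
  sSup {x | ∃ S : Finset V, x = |netSupply b S|}

/-- `b*_min = min { |b(S)| : S ⊆ V, b(S) ≠ 0 }`. -/
noncomputable def bstarMin (b : V → ℝ) : ℝ :=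
  sInf {x | ∃ S : Finset V, netSupply b S ≠ 0 ∧ x = |netSupply b S|}

/-- The support of an arc vector. -/
def suppE (φ : E → ℝ) : Set E := {e | φ e ≠ 0}

/-- An arc set is a forest in the underlying undirected graph:
equivalently, it supports no nonzero circulation. -/
def ForestSupport (tail head : E → V) (s : Set E) : Prop :=
  ∀ γ : E → ℝ, (incMatrix tail head).mulVec γ = 0 → (∀ e, γ e ≠ 0 → e ∈ s) → γ = 0

/-- A basic feasible solution: a positive flow whose support is a forest
in the underlying undirected graph. -/
def IsBFS (tail head : E → V) (b : V → ℝ) (f : E → ℝ) : Prop :=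
  IsFlow tail head b f ∧ (∀ e, 0 ≤ f e) ∧ ForestSupport tail head (suppE f)

/-- A vector is circulation free if its support contains no directed cycle:
equivalently, it supports no nonzero nonnegative circulation. -/
def CirculationFree (tail head : E → V) (φ : E → ℝ) : Prop :=
  ∀ γ : E → ℝ, (incMatrix tail head).mulVec γ = 0 → (∀ e, 0 ≤ γ e) →
    (∀ e, γ e ≠ 0 → φ e ≠ 0) → γ = 0

/-- The weighted graph Laplacian `L(σ) = B · diag(σ/ℓ) · Bᵀ`. -/
noncomputable def lap (tail head : E → V) (ℓ σ : E → ℝ) : Matrix V V ℝ :=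
  incMatrix tail head * Matrix.diagonal (fun e => σ e / ℓ e) * (incMatrix tail head).transpose

/-- The field (slope) of a potential: `Ψ(p)_{ij} = (p_i - p_j)/ℓ_{ij}`. -/
noncomputable def field (tail head : E → V) (ℓ : E → ℝ) (p : V → ℝ) : E → ℝ :=
  fun e => (p (tail e) - p (head e)) / ℓ e

/-- The set of vertices incident to an arc set `H`. -/
def VSet (tail head : E → V) (H : Set E) : Set V :=
  {i | ∃ e ∈ H, tail e = i ∨ head e = i}

/-- Undirected reachability using only arcs in `H`. -/
def UReach (tail head : E → V) (H : Set E) : V → V → Prop :=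
  Relation.ReflTransGen
    (fun i j => ∃ e ∈ H, (tail e = i ∧ head e = j) ∨ (tail e = j ∧ head e = i))

/-- `WalkLen tail head ℓ H i j L`: there is a walk in the underlying undirected
graph of `H` from `i` to `j` of total `ℓ`-length `L`. -/
inductive WalkLen (tail head : E → V) (ℓ : E → ℝ) (H : Set E) : V → V → ℝ → Prop
  | refl (i : V) : WalkLen tail head ℓ H i i 0
  | step {j k : V} {L : ℝ} (i : V) (e : E) (he : e ∈ H)
      (hik : (tail e = i ∧ head e = j) ∨ (tail e = j ∧ head e = i))
      (hw : WalkLen tail head ℓ H j k L) : WalkLen tail head ℓ H i k (ℓ e + L)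

/-- The minimal `ℓ`-length of a connecting walk within `H`. -/
noncomputable def wdist (tail head : E → V) (ℓ : E → ℝ) (H : Set E) (i j : V) : ℝ :=
  sInf {L | WalkLen tail head ℓ H i j L}

/-- The `ℓ`-diameter of `H`: the maximum of `wdist` over pairs of vertices lying in
a common component of `H`. -/
noncomputable def wdiam (tail head : E → V) (ℓ : E → ℝ) (H : Set E) : ℝ :=
  sSup {x | ∃ i j : V, (∃ L, WalkLen tail head ℓ H i j L) ∧ x = wdist tail head ℓ H i j}

/-- Maximum norm of `p` restricted to a vertex set `A`. -/
noncomputable def supNormOn (A : Set V) (p : V → ℝ) : ℝ := sSup {x | ∃ i ∈ A, x = |p i|}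

/-- Maximum norm of an arc vector. -/
noncomputable def eSupNorm (x : E → ℝ) : ℝ := sSup {r | ∃ e : E, r = |x e|}

/-- `min { σ_e : σ_e > 0 }`. -/
noncomputable def minPos (σ : E → ℝ) : ℝ := sInf {x | ∃ e, 0 < σ e ∧ x = σ e}

/-- `min_e ℓ_e`. -/
noncomputable def minLen (ℓ : E → ℝ) : ℝ := sInf {x | ∃ e : E, x = ℓ e}

/-- The cost `ℓᵀφ` of a flow. -/
def cost (ℓ φ : E → ℝ) : ℝ := ∑ e, ℓ e * φ e

/-- The transshipment problem is feasible: there is a positive flow. -/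
def Feasible (tail head : E → V) (b : V → ℝ) : Prop :=
  ∃ φ : E → ℝ, IsFlow tail head b φ ∧ ∀ e, 0 ≤ φ e

/-- `φ` is a minimum-cost positive flow. -/
def IsOptimal (tail head : E → V) (ℓ : E → ℝ) (b : V → ℝ) (φ : E → ℝ) : Prop :=
  IsFlow tail head b φ ∧ (∀ e, 0 ≤ φ e) ∧
    ∀ ψ : E → ℝ, IsFlow tail head b ψ → (∀ e, 0 ≤ ψ e) → cost ℓ φ ≤ cost ℓ ψ

/-- `Ĥ`: the set of arcs carried by some minimum-cost positive flow. -/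
def optSupport (tail head : E → V) (ℓ : E → ℝ) (b : V → ℝ) : Set E :=
  {e | ∃ φ : E → ℝ, IsOptimal tail head ℓ b φ ∧ 0 < φ e}

/-- The current `φ(t) = σ(t)·Ψ(p(t))` of the Physarum solver. -/
noncomputable def current (tail head : E → V) (ℓ : E → ℝ) (σ : ℝ → E → ℝ)
    (p : ℝ → V → ℝ) (t : ℝ) : E → ℝ :=
  fun e => σ t e * field tail head ℓ (p t) e

/-- The Physarum dynamics: `σ(t) > 0` and continuously differentiable on `[0,∞)`,
`L(σ(t)) p(t) = b`, and `σ' = φ - σ` where `φ(t) = σ(t)·Ψ(p(t))`. -/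
structure PhysarumDynamics (tail head : E → V) (ℓ : E → ℝ) (b : V → ℝ)
    (σ : ℝ → E → ℝ) (p : ℝ → V → ℝ) : Prop where
  pos : ∀ t : ℝ, 0 ≤ t → ∀ e, 0 < σ t e
  kirchhoff : ∀ t : ℝ, 0 ≤ t → (lap tail head ℓ (σ t)).mulVec (p t) = b
  contp : ContinuousOn (fun t => p t) (Set.Ici (0 : ℝ))
  dyn : ∀ t ∈ Set.Ici (0 : ℝ), ∀ e : E,
    HasDerivWithinAt (fun s => σ s e)
      (current tail head ℓ σ p t e - σ t e) (Set.Ici (0 : ℝ)) t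

/-- A directed walk from `i` to `j` using the listed arcs in order. -/
inductive DiWalk (tail head : E → V) : V → V → List E → Prop
  | nil (i : V) : DiWalk tail head i i []
  | cons {j k : V} {es : List E} (i : V) (e : E) (h1 : tail e = i) (h2 : head e = j)
      (hw : DiWalk tail head j k es) : DiWalk tail head i k (e :: es)

/-- Discrete `∞`-harmonicity of `p` at node `i` with respect to the arc set `H`:
the maximal in-slope equals the maximal out-slope, and both are nonnegative. -/
noncomputable def InfHarmAt (tail head : E → V) (ℓ : E → ℝ) (H : Set E)
    (p : V → ℝ) (i : V) : Prop :=
  sSup {r | ∃ e ∈ H, head e = i ∧ r = (p (tail e) - p i) / ℓ e}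
    = sSup {r | ∃ e ∈ H, tail e = i ∧ r = (p i - p (head e)) / ℓ e}
  ∧ 0 ≤ sSup {r | ∃ e ∈ H, tail e = i ∧ r = (p i - p (head e)) / ℓ e}

end PhysarumSetup

open Filter Topology Set

/-- **Stiemke's lemma**: a subspace meeting the nonnegative orthant only at the origin is
orthogonal to a strictly positive vector. -/
theorem exists_pos_orthogonal {ι : Type*} [Fintype ι] [DecidableEq ι] (L : Submodule ℝ (ι → ℝ))
    (h : ∀ x ∈ L, (∀ i, 0 ≤ x i) → x = 0) :
    ∃ y : ι → ℝ, (∀ i, 0 < y i) ∧ ∀ x ∈ L, ∑ i, y i * x i = 0 := by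
  obtain ⟨f, u, v, hu, huv, hv⟩ := geometric_hahn_banach_closed_compact
    (s := (L : Set (ι → ℝ))) (t := stdSimplex ℝ ι) L.convex L.closed_of_finiteDimensional
    (convex_stdSimplex ℝ ι) (isCompact_stdSimplex ℝ ι) (by
      rw [Set.disjoint_left]
      intro x hx hx'
      have := h x hx hx'.1
      have h1 := hx'.2
      simp [this] at h1)
  have hu0 : 0 < u := by simpa using hu 0 L.zero_mem
  have hf0 : ∀ x ∈ L, f x = 0 := by
    intro x hx
    by_contra hne
    have := hu ((u / f x) • x) (L.smul_mem _ hx)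
    rw [map_smul, smul_eq_mul, div_mul_cancel₀ _ hne] at this
    exact lt_irrefl _ this
  refine ⟨fun i => f (Pi.single i 1), fun i => ?_, fun x hx => ?_⟩
  · exact (hu0.trans huv).trans (hv _ (single_mem_stdSimplex ℝ i))
  · rw [← hf0 x hx]
    conv_rhs => rw [pi_eq_sum_univ' x, map_sum]
    refine Finset.sum_congr rfl fun i _ => ?_
    rw [map_smul, smul_eq_mul, mul_comm]

/-- A function on `[0, ∞)` with nonnegative derivative stays above its initial value. -/
theorem le_of_hasDerivWithinAt_nonneg {f f' : ℝ → ℝ}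
    (hf : ∀ t, 0 ≤ t → HasDerivWithinAt f (f' t) (Ici 0) t) (hf' : ∀ t, 0 ≤ t → 0 ≤ f' t)
    {t : ℝ} (ht : 0 ≤ t) : f 0 ≤ f t := by
  refine monotoneOn_of_hasDerivWithinAt_nonneg (convex_Ici 0)
    (fun x hx => (hf x hx).continuousWithinAt) (f' := f') (fun x hx => ?_) (fun x hx => ?_)
    self_mem_Ici ht ht
  · exact (hf x (interior_subset hx)).mono interior_subset
  · exact hf' x (interior_subset hx)

/-- A function on `[0, ∞)` with vanishing derivative is constant. -/
theorem eq_of_hasDerivWithinAt_zero {f : ℝ → ℝ}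
    (hf : ∀ t, 0 ≤ t → HasDerivWithinAt f 0 (Ici 0) t) {t : ℝ} (ht : 0 ≤ t) : f t = f 0 := by
  refine le_antisymm ?_ (le_of_hasDerivWithinAt_nonneg (f' := fun _ => 0) hf (by simp) ht)
  have := le_of_hasDerivWithinAt_nonneg (f := fun t => -f t) (f' := fun _ => -0)
    (fun t ht => (hf t ht).neg) (by simp) ht
  simpa using this

/-- Among `card ι + 1` consecutive intervals of length `w`, one contains no value of `q`. -/
theorem exists_nat_forall_lt_or_le {ι : Type*} [Fintype ι] (q : ι → ℝ) (c : ℝ) {w : ℝ}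
    (hw : 0 < w) :
    ∃ k ≤ Fintype.card ι, ∀ i, q i < c + k * w ∨ c + ((k : ℝ) + 1) * w ≤ q i := by
  by_contra! hcon
  have : ∀ k : Fin (Fintype.card ι + 1), ∃ i,
      c + (k : ℕ) * w ≤ q i ∧ q i < c + ((k : ℕ) + 1 : ℝ) * w :=
    fun k => hcon k (Nat.lt_succ_iff.1 k.2)
  choose g hg hg' using this
  have hlt : ∀ k l, k < l → g k ≠ g l := by
    intro k l hkl hEq
    have h1 := hg' k
    have h2 := hg l
    rw [hEq] at h1
    have h3 : ((k : ℕ) : ℝ) + 1 ≤ (l : ℕ) := by exact_mod_cast hkl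
    have := mul_le_mul_of_nonneg_right h3 hw.le
    linarith
  have hinj : Function.Injective g := by
    intro k l hkl
    by_contra hne
    rcases lt_or_gt_of_ne hne with h | h
    · exact hlt k l h hkl
    · exact hlt l k h hkl.symm
  have := Fintype.card_le_of_injective _ hinj
  simp at this

section PhysarumDecay

variable {V E : Type*} [DecidableEq V] {tail head : E → V} {ℓ : E → ℝ} {b : V → ℝ}

theorem incMatrix_transpose_mulVec [Fintype V] (hloops : NoLoops tail head) (x : V → ℝ) (e : E) :
    ((incMatrix tail head).transpose.mulVec x) e = x (tail e) - x (head e) := by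
  have : ∀ i, incMatrix tail head i e * x i
      = (if tail e = i then x i else 0) - (if head e = i then x i else 0) := by
    intro i
    have := hloops e
    by_cases h1 : tail e = i
    · have h2 : head e ≠ i := by rintro rfl; exact this h1
      simp [incMatrix, h1, h2]
    · by_cases h2 : head e = i <;> simp [incMatrix, h1, h2]
  simp only [Matrix.mulVec, dotProduct, Matrix.transpose_apply, this, Finset.sum_sub_distrib]
  simp

variable [Fintype E]

theorem sum_mul_incMatrix_mulVec [Fintype V] (hloops : NoLoops tail head) (x : V → ℝ) (φ : E → ℝ) :
    ∑ i, x i * (incMatrix tail head).mulVec φ i = ∑ e, (x (tail e) - x (head e)) * φ e := by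
  have := Matrix.dotProduct_mulVec x (incMatrix tail head) φ
  rw [← Matrix.mulVec_transpose] at this
  simpa [dotProduct, incMatrix_transpose_mulVec hloops] using this

/-- If `q` varies by less than `w` along every arc carrying the flow `φ` of divergence `b`, then
an arc along which `q` drops by at least `(card V + 1) * w` crosses a cut of zero net supply, so
its weight `y e` is controlled by the divergence excess and the weights of the arcs along which
`q` rises by at least `w`. -/
theorem le_of_large_drop [Fintype V] (hloops : NoLoops tail head) {φ y : E → ℝ}
    (hφ : IsFlow tail head b φ)
    (hy : ∀ e, 0 ≤ y e) {q : V → ℝ} {w η : ℝ} (hw : 0 < w) (hη : 0 ≤ η)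
    (hqφ : ∀ e, φ e ≠ 0 → |q (tail e) - q (head e)| < w)
    (hrise : ∀ e, w ≤ q (head e) - q (tail e) → y e ≤ η) {e : E}
    (hdrop : (Fintype.card V + 1) * w ≤ q (tail e) - q (head e)) :
    y e ≤ ∑ i, |(incMatrix tail head).mulVec y i - b i| + Fintype.card E * η := by
  obtain ⟨k, hk, hgap⟩ := exists_nat_forall_lt_or_le q (q (head e)) hw
  set c := q (head e) + k * w with hc
  have hgap' : ∀ i, q i < c ∨ c + w ≤ q i := by
    intro i
    refine (hgap i).imp_right fun h => ?_
    rw [hc]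
    linarith
  have hkw : 0 ≤ k * w := by positivity
  let χ : V → ℝ := fun i => if c + w ≤ q i then 1 else 0
  have hφ0 : ∑ i, χ i * b i = 0 := by
    rw [← hφ, sum_mul_incMatrix_mulVec hloops]
    refine Finset.sum_eq_zero fun f _ => ?_
    by_cases hf : φ f = 0
    · rw [hf, mul_zero]
    have h1 := abs_lt.1 (hqφ f hf)
    have h2 : χ (tail f) = χ (head f) := by
      rcases hgap' (tail f) with ht | ht <;> rcases hgap' (head f) with hh | hh
      · simp [χ, not_le.2 (ht.trans (lt_add_of_pos_right c hw)),
          not_le.2 (hh.trans (lt_add_of_pos_right c hw))]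
      · linarith
      · linarith
      · simp [χ, ht, hh]
    rw [h2, sub_self, zero_mul]
  have hdiv : ∑ f, (χ (tail f) - χ (head f)) * y f
      ≤ ∑ i, |(incMatrix tail head).mulVec y i - b i| := by
    rw [← sum_mul_incMatrix_mulVec hloops, ← sub_zero (Finset.sum _ _), ← hφ0,
      ← Finset.sum_sub_distrib]
    refine Finset.sum_le_sum fun i _ => ?_
    rw [← mul_sub]
    by_cases hi : c + w ≤ q i
    · simpa [χ, hi] using le_abs_self ((incMatrix tail head).mulVec y i - b i)
    · simp [χ, hi]
  have hterm : ∀ f, -η ≤ (χ (tail f) - χ (head f)) * y f := by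
    intro f
    by_cases ht : c + w ≤ q (tail f)
    · have h1 : 0 ≤ (χ (tail f) - χ (head f)) * y f := by
        refine mul_nonneg ?_ (hy f)
        by_cases hh : c + w ≤ q (head f) <;> simp [χ, ht, hh]
      linarith
    · by_cases hh : c + w ≤ q (head f)
      · have h1 := hrise f (by linarith [(hgap' (tail f)).resolve_right ht])
        simpa [χ, ht, hh] using h1
      · simpa [χ, ht, hh] using hη
  have he : (χ (tail e) - χ (head e)) * y e = y e := by
    have hkn : (k : ℝ) ≤ Fintype.card V := by exact_mod_cast hk
    have h1 := mul_le_mul_of_nonneg_right hkn hw.le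
    have h2 : c + w ≤ q (tail e) := by rw [hc]; linarith
    have h3 : ¬ c + w ≤ q (head e) := by rw [hc]; linarith
    simp [χ, h2, h3]
  have hsum : y e ≤ ∑ f, (χ (tail f) - χ (head f)) * y f + Fintype.card E * η := by
    have h1 : ∑ f, ((χ (tail f) - χ (head f)) * y f + η)
        = ∑ f, (χ (tail f) - χ (head f)) * y f + Fintype.card E * η := by
      simp [Finset.sum_add_distrib]
    rw [← h1]
    have h2 := Finset.single_le_sum
      (fun f _ => by linarith [hterm f] : ∀ f ∈ Finset.univ,
        0 ≤ (χ (tail f) - χ (head f)) * y f + η) (Finset.mem_univ e)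
    simp only [he] at h2
    linarith
  linarith

/-- A functional on arc vectors that vanishes on circulations is a potential difference. -/
theorem exists_potential_of_orthogonal [Fintype V] [DecidableEq E] (hloops : NoLoops tail head)
    (r : E → ℝ)
    (hr : ∀ γ : E → ℝ, (incMatrix tail head).mulVec γ = 0 → ∑ e, r e * γ e = 0) :
    ∃ x : V → ℝ, ∀ e, x (tail e) - x (head e) = r e := by
  let R : Module.Dual ℝ (E → ℝ) := Fintype.linearCombination ℝ r
  have hR : R ∈ LinearMap.range (incMatrix tail head).mulVecLin.dualMap := by
    rw [LinearMap.range_dualMap_eq_dualAnnihilator_ker, Submodule.mem_dualAnnihilator]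
    intro γ hγ
    have := hr γ (by simpa using hγ)
    simpa [R, Fintype.linearCombination_apply, mul_comm] using this
  obtain ⟨g, hg⟩ := hR
  refine ⟨fun i => g (Pi.single i 1), fun e => ?_⟩
  have h1 := LinearMap.congr_fun hg (Pi.single e 1)
  have h2 : R (Pi.single e 1) = r e := by simp [R]
  rw [← h2, ← h1, LinearMap.dualMap_apply, Matrix.mulVecLin_apply]
  have h3 : ∀ z : V → ℝ, g z = ∑ i, g (Pi.single i 1) * z i := by
    intro z
    conv_lhs => rw [LinearMap.pi_apply_eq_sum_univ g z]
    refine Finset.sum_congr rfl fun i _ => ?_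
    rw [smul_eq_mul, mul_comm]
    congr 2
    ext j
    simp [Pi.single_apply, eq_comm]
  rw [h3, sum_mul_incMatrix_mulVec hloops (fun i => g (Pi.single i 1))]
  simp [Pi.single_apply]

theorem exists_isOptimal (hℓ : ∀ e, 0 < ℓ e) (hfeas : Feasible tail head b) :
    ∃ φ, IsOptimal tail head ℓ b φ := by
  obtain ⟨φ₀, h₀, h₀'⟩ := hfeas
  have hcost : Continuous (cost ℓ) := by unfold cost; fun_prop
  let K : Set (E → ℝ) := {φ | IsFlow tail head b φ ∧ (∀ e, 0 ≤ φ e) ∧ cost ℓ φ ≤ cost ℓ φ₀}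
  have hK : IsCompact K := by
    refine (isCompact_Icc (a := (0 : E → ℝ)) (b := fun e => cost ℓ φ₀ / ℓ e)).of_isClosed_subset
      ?_ ?_
    · refine IsClosed.inter ?_ (IsClosed.inter ?_ ?_)
      · exact isClosed_eq (Continuous.matrix_mulVec continuous_const continuous_id)
          continuous_const
      · exact isClosed_Ici (a := (0 : E → ℝ))
      · exact isClosed_le hcost continuous_const
    · rintro φ ⟨-, h1, h2⟩
      refine ⟨h1, fun e => ?_⟩
      rw [le_div_iff₀ (hℓ e), mul_comm]
      exact (Finset.single_le_sum (f := fun e => ℓ e * φ e)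
        (fun e _ => mul_nonneg (hℓ e).le (h1 e)) (Finset.mem_univ e)).trans h2
  obtain ⟨φ, ⟨h1, h2, h3⟩, hmin⟩ := hK.exists_isMinOn ⟨φ₀, h₀, h₀', le_rfl⟩ hcost.continuousOn
  refine ⟨φ, h1, h2, fun ψ hψ hψ' => ?_⟩
  rcases le_total (cost ℓ ψ) (cost ℓ φ₀) with h | h
  · exact hmin ⟨hψ, hψ', h⟩
  · exact h3.trans h

theorem convex_isOptimal : Convex ℝ {φ | IsOptimal tail head ℓ b φ} := by
  rintro φ ⟨hφ, hφ0, hφm⟩ ψ ⟨hψ, hψ0, hψm⟩ u v hu hv huv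
  refine ⟨?_, fun e => ?_, fun χ hχ hχ0 => ?_⟩
  · rw [IsFlow, Matrix.mulVec_add, Matrix.mulVec_smul, Matrix.mulVec_smul, hφ, hψ, ← add_smul,
      huv, one_smul]
  · exact add_nonneg (mul_nonneg hu (hφ0 e)) (mul_nonneg hv (hψ0 e))
  · have : cost ℓ (u • φ + v • ψ) = u * cost ℓ φ + v * cost ℓ ψ := by
      simp only [cost, Finset.mul_sum, ← Finset.sum_add_distrib]
      refine Finset.sum_congr rfl fun e _ => ?_
      simp only [Pi.add_apply, Pi.smul_apply, smul_eq_mul]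
      ring
    rw [this]
    have h1 := mul_le_mul_of_nonneg_left (hφm χ hχ hχ0) hu
    have h2 := mul_le_mul_of_nonneg_left (hψm χ hχ hχ0) hv
    calc _ ≤ u * cost ℓ χ + v * cost ℓ χ := add_le_add h1 h2
      _ = cost ℓ χ := by rw [← add_mul, huv, one_mul]

/-- Some optimal flow carries every arc of the optimal support. -/
theorem exists_isOptimal_pos_on_optSupport (hℓ : ∀ e, 0 < ℓ e) (hfeas : Feasible tail head b) :
    ∃ φ, IsOptimal tail head ℓ b φ ∧ ∀ e ∈ optSupport tail head ℓ b, 0 < φ e := by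
  obtain ⟨φ₀, h₀⟩ := exists_isOptimal hℓ hfeas
  rcases isEmpty_or_nonempty E with hE | hE
  · exact ⟨φ₀, h₀, fun e => hE.elim e⟩
  have : ∀ e, ∃ φ, IsOptimal tail head ℓ b φ ∧ (e ∈ optSupport tail head ℓ b → 0 < φ e) := by
    intro e
    by_cases he : e ∈ optSupport tail head ℓ b
    · obtain ⟨φ, h, h'⟩ := he
      exact ⟨φ, h, fun _ => h'⟩
    · exact ⟨φ₀, h₀, fun h => absurd h he⟩
  choose F hF hF' using this
  have hcard : (0 : ℝ) < Fintype.card E := by exact_mod_cast Fintype.card_pos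
  refine ⟨∑ e, (Fintype.card E : ℝ)⁻¹ • F e, ?_, fun e he => ?_⟩
  · refine convex_isOptimal.sum_mem (fun _ _ => by positivity) ?_ fun e _ => hF e
    simp [hcard.ne']
  · rw [Finset.sum_apply]
    refine Finset.sum_pos' (fun f _ => ?_) ⟨e, Finset.mem_univ _, ?_⟩
    · exact mul_nonneg (by positivity) ((hF f).2.1 e)
    · exact mul_pos (by positivity) (hF' e he)

/-- **Strict complementarity**: there is a dual solution whose slack is positive exactly off the
optimal support. -/
theorem exists_strict_dual [Fintype V] [DecidableEq E] (hloops : NoLoops tail head) {φ : E → ℝ}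
    (hφ : IsOptimal tail head ℓ b φ) (hpos : ∀ e ∈ optSupport tail head ℓ b, 0 < φ e) :
    ∃ (x : V → ℝ) (s : E → ℝ), (∀ e, ℓ e = x (tail e) - x (head e) + s e) ∧
      (∀ e ∈ optSupport tail head ℓ b, s e = 0) ∧
      (∀ e, e ∉ optSupport tail head ℓ b → 0 < s e) := by
  classical
  let T : (E → ℝ) →ₗ[ℝ] (Option E → ℝ) :=
    { toFun := fun γ o => o.elim (-cost ℓ γ)
        (fun f => if f ∈ optSupport tail head ℓ b then 0 else γ f)
      map_add' := by
        intro γ δ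
        ext (_ | f)
        · simp [cost, mul_add, Finset.sum_add_distrib]; ring
        · by_cases hf : f ∈ optSupport tail head ℓ b <;> simp [hf]
      map_smul' := by
        intro c γ
        ext (_ | f)
        · simp [cost, Finset.mul_sum, mul_left_comm]
        · by_cases hf : f ∈ optSupport tail head ℓ b <;> simp [hf] }
  have hTn : ∀ γ, T γ none = -cost ℓ γ := fun _ => rfl
  have hTs : ∀ γ f, T γ (some f) = if f ∈ optSupport tail head ℓ b then 0 else γ f :=
    fun _ _ => rfl
  obtain ⟨y, hy, hyL⟩ := exists_pos_orthogonal
    ((LinearMap.ker (incMatrix tail head).mulVecLin).map T) (by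
      rintro _ ⟨γ, hγ, rfl⟩ hx
      have hγ' : (incMatrix tail head).mulVec γ = 0 := by simpa using hγ
      have hoff : ∀ f, f ∉ optSupport tail head ℓ b → 0 ≤ γ f := by
        intro f hf
        simpa [hTs, hf] using hx (some f)
      have hc : cost ℓ γ ≤ 0 := by simpa [hTn] using hx none
      have hev : ∀ᶠ ε in 𝓝[>] (0 : ℝ), ∀ f, 0 ≤ φ f + ε * γ f := by
        rw [eventually_all]
        intro f
        by_cases hf : f ∈ optSupport tail head ℓ b
        · have hcont : Tendsto (fun ε : ℝ => φ f + ε * γ f) (𝓝[>] 0) (𝓝 (φ f + 0 * γ f)) :=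
            tendsto_nhdsWithin_of_tendsto_nhds (Continuous.tendsto (by fun_prop) 0)
          have : 0 < φ f + 0 * γ f := by simpa using hpos f hf
          filter_upwards [hcont.eventually (lt_mem_nhds this)] with ε hε using hε.le
        · filter_upwards [self_mem_nhdsWithin] with ε hε
          exact add_nonneg (hφ.2.1 f) (mul_nonneg (le_of_lt hε) (hoff f hf))
      obtain ⟨ε, hε, hε0⟩ := (hev.and self_mem_nhdsWithin).exists
      replace hε0 : 0 < ε := hε0
      have hflow : IsFlow tail head b (φ + ε • γ) := by
        rw [IsFlow, Matrix.mulVec_add, Matrix.mulVec_smul, hγ', smul_zero, add_zero]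
        exact hφ.1
      have hcost : cost ℓ (φ + ε • γ) = cost ℓ φ + ε * cost ℓ γ := by
        simp only [cost, Finset.mul_sum, ← Finset.sum_add_distrib]
        refine Finset.sum_congr rfl fun e _ => ?_
        simp only [Pi.add_apply, Pi.smul_apply, smul_eq_mul]
        ring
      have hopt : IsOptimal tail head ℓ b (φ + ε • γ) := by
        refine ⟨hflow, hε, fun ψ h1 h2 => ?_⟩
        rw [hcost]
        have := hφ.2.2 ψ h1 h2
        nlinarith
      ext (_ | f)
      · have := hφ.2.2 _ hflow hε
        rw [hcost] at this
        have : 0 ≤ cost ℓ γ := by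
          by_contra! h
          nlinarith
        rw [hTn, le_antisymm hc this]
        simp
      · by_cases hf : f ∈ optSupport tail head ℓ b
        · simp [hTs, hf]
        · simp only [hTs, hf, if_false, Pi.zero_apply]
          by_contra hne
          have hgt : 0 < γ f := lt_of_le_of_ne (hoff f hf) (Ne.symm hne)
          refine hf ⟨_, hopt, ?_⟩
          exact add_pos_of_nonneg_of_pos (hφ.2.1 f) (mul_pos hε0 hgt))
  let s : E → ℝ := fun f => if f ∈ optSupport tail head ℓ b then 0 else y (some f) / y none
  obtain ⟨x, hx⟩ := exists_potential_of_orthogonal hloops (fun e => ℓ e - s e) (by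
    intro γ hγ
    have h1 := hyL (T γ) ⟨γ, by simpa using hγ, rfl⟩
    rw [Fintype.sum_option, hTn] at h1
    have h2 : ∑ f, y (some f) * T γ (some f) = y none * ∑ f, s f * γ f := by
      rw [Finset.mul_sum]
      refine Finset.sum_congr rfl fun f _ => ?_
      rw [hTs]
      by_cases hf : f ∈ optSupport tail head ℓ b
      · simp [s, hf]
      · simp only [s, hf, if_false]
        field_simp [(hy none).ne']
    rw [h2, ← mul_add] at h1
    have h3 := (mul_eq_zero.1 h1).resolve_left (hy none).ne'
    simp only [cost] at h3
    simp only [sub_mul, Finset.sum_sub_distrib]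
    linarith)
  refine ⟨x, s, fun e => by rw [hx]; ring, fun e he => by simp [s, he], fun e he => ?_⟩
  simp only [s, he, if_false]
  exact div_pos (hy _) (hy _)

variable [Fintype V] [DecidableEq E] {σ : ℝ → E → ℝ} {p : ℝ → V → ℝ}

namespace PhysarumDynamics

theorem incMatrix_mulVec_current (hloops : NoLoops tail head)
    (h : PhysarumDynamics tail head ℓ b σ p) {t : ℝ} (ht : 0 ≤ t) :
    (incMatrix tail head).mulVec (current tail head ℓ σ p t) = b := by
  rw [← h.kirchhoff t ht, lap, ← Matrix.mulVec_mulVec, ← Matrix.mulVec_mulVec]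
  congr 1
  ext e
  rw [Matrix.mulVec_diagonal, incMatrix_transpose_mulVec hloops]
  simp only [current, field]
  ring

/-- Currents are bounded by the total source strength, by cutting along a level set of `p`. -/
theorem current_le (hloops : NoLoops tail head) (hℓ : ∀ e, 0 < ℓ e)
    (h : PhysarumDynamics tail head ℓ b σ p) {t : ℝ} (ht : 0 ≤ t) (e : E) :
    current tail head ℓ σ p t e ≤ ∑ i, |b i| := by
  have hB : 0 ≤ ∑ i, |b i| := Finset.sum_nonneg fun i _ => abs_nonneg _
  have hσ := h.pos t ht
  rcases le_or_gt (p t (tail e)) (p t (head e)) with hle | hgt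
  · refine le_trans ?_ hB
    exact mul_nonpos_of_nonneg_of_nonpos (hσ e).le
      (div_nonpos_of_nonpos_of_nonneg (by linarith) (hℓ e).le)
  let χ : V → ℝ := fun i => if p t (tail e) ≤ p t i then 1 else 0
  have hχ := sum_mul_incMatrix_mulVec hloops χ (current tail head ℓ σ p t)
  rw [h.incMatrix_mulVec_current hloops ht] at hχ
  have h1 : ∑ i, χ i * b i ≤ ∑ i, |b i| := by
    refine Finset.sum_le_sum fun i _ => ?_
    by_cases hi : p t (tail e) ≤ p t i
    · simpa [χ, hi] using le_abs_self _
    · simp [χ, hi]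
  refine le_trans ?_ h1
  rw [hχ]
  have h2 : ∀ f ∈ Finset.univ,
      0 ≤ (χ (tail f) - χ (head f)) * current tail head ℓ σ p t f := by
    intro f _
    have hmono : ∀ i j, p t i ≤ p t j → χ i ≤ χ j := by
      intro i j hij
      by_cases hi : p t (tail e) ≤ p t i
      · simp [χ, hi, hi.trans hij]
      · by_cases hj : p t (tail e) ≤ p t j <;> simp [χ, hi, hj]
    rcases le_total (p t (tail f)) (p t (head f)) with hf | hf
    · refine mul_nonneg_of_nonpos_of_nonpos (sub_nonpos.2 (hmono _ _ hf)) ?_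
      exact mul_nonpos_of_nonneg_of_nonpos (hσ f).le
        (div_nonpos_of_nonpos_of_nonneg (by linarith) (hℓ f).le)
    · refine mul_nonneg (sub_nonneg.2 (hmono _ _ hf)) ?_
      exact mul_nonneg (hσ f).le (div_nonneg (by linarith) (hℓ f).le)
  have h3 := Finset.single_le_sum h2 (Finset.mem_univ e)
  simpa [χ, not_le.2 hgt] using h3

theorem exists_le (hloops : NoLoops tail head) (hℓ : ∀ e, 0 < ℓ e)
    (h : PhysarumDynamics tail head ℓ b σ p) :
    ∃ M, 1 ≤ M ∧ ∀ t, 0 ≤ t → ∀ e, σ t e ≤ M := by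
  set β := ∑ i, |b i| with hβ
  have hB : 0 ≤ β := Finset.sum_nonneg fun i _ => abs_nonneg _
  have h0 := fun e => (h.pos 0 le_rfl e).le
  refine ⟨1 + β + ∑ e, σ 0 e, ?_, fun t ht e => ?_⟩
  · have := Finset.sum_nonneg fun e (_ : e ∈ Finset.univ) => h0 e
    linarith
  have key := le_of_hasDerivWithinAt_nonneg (f := fun t => Real.exp t * (β - σ t e))
    (f' := fun t => Real.exp t * (β - current tail head ℓ σ p t e))
    (fun t ht => by
      refine ((Real.hasDerivAt_exp t).hasDerivWithinAt.mul
        ((h.dyn t ht e).const_sub β)).congr_deriv ?_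
      ring)
    (fun t ht => mul_nonneg (Real.exp_pos t).le
      (sub_nonneg.2 (h.current_le hloops hℓ ht e))) ht
  have h1 := Finset.single_le_sum (fun e _ => h0 e) (Finset.mem_univ e)
  simp only [Real.exp_zero, one_mul] at key
  by_contra! hlt
  have h2 : Real.exp t * (β - σ t e) ≤ 1 * (β - σ t e) :=
    mul_le_mul_of_nonpos_right (Real.one_le_exp ht) (by linarith [h0 e])
  linarith

/-- The divergence of `σ` relaxes to `b` exponentially. -/
theorem incMatrix_mulVec (hloops : NoLoops tail head)
    (h : PhysarumDynamics tail head ℓ b σ p) {t : ℝ} (ht : 0 ≤ t) (i : V) :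
    (incMatrix tail head).mulVec (σ t) i
      = b i + Real.exp (-t) * ((incMatrix tail head).mulVec (σ 0) i - b i) := by
  have key := eq_of_hasDerivWithinAt_zero
    (f := fun t => Real.exp t * ((incMatrix tail head).mulVec (σ t) i - b i))
    (fun t ht => by
      have h1 : HasDerivWithinAt (fun t => (incMatrix tail head).mulVec (σ t) i)
          (∑ e, incMatrix tail head i e * (current tail head ℓ σ p t e - σ t e)) (Ici 0) t :=
        HasDerivWithinAt.fun_sum fun e _ => (h.dyn t ht e).const_mul _
      have h2 : ∑ e, incMatrix tail head i e * (current tail head ℓ σ p t e - σ t e)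
          = b i - (incMatrix tail head).mulVec (σ t) i := by
        conv_rhs => rw [← h.incMatrix_mulVec_current hloops ht]
        simp only [mul_sub, Finset.sum_sub_distrib]
        rfl
      rw [h2] at h1
      refine ((Real.hasDerivAt_exp t).hasDerivWithinAt.mul
        (h1.sub_const (b i))).congr_deriv ?_
      ring) ht
  simp only [Real.exp_zero, one_mul] at key
  rw [← key, ← mul_assoc, ← Real.exp_add]
  simp

theorem hasDerivWithinAt_log (h : PhysarumDynamics tail head ℓ b σ p) {t : ℝ} (ht : 0 ≤ t)
    (e : E) : HasDerivWithinAt (fun t => Real.log (σ t e))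
      (field tail head ℓ (p t) e - 1) (Ici 0) t := by
  have hne := (h.pos t ht e).ne'
  convert (h.dyn t ht e).log hne using 1
  simp only [current]
  field_simp

/-- The logarithmic growth of `σ` is a potential difference, up to the drift `-ℓ t`. -/
theorem exists_potential (hℓ : ∀ e, 0 < ℓ e) (h : PhysarumDynamics tail head ℓ b σ p) :
    ∃ P : ℝ → V → ℝ, ∀ t, 0 ≤ t → ∀ e,
      ℓ e * (Real.log (σ t e) - Real.log (σ 0 e))
        = P t (tail e) - P t (head e) - ℓ e * t := by
  have hcont : ∀ i, Continuous fun x : ℝ => p (max x 0) i := by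
    intro i
    have : Continuous fun x : ℝ => p (max x 0) :=
      h.contp.comp_continuous (by fun_prop) fun x => mem_Ici.2 (le_max_right _ _)
    exact (continuous_apply i).comp this
  refine ⟨fun t i => ∫ x in (0 : ℝ)..t, p (max x 0) i, fun t ht e => ?_⟩
  have hP : ∀ i t, 0 ≤ t →
      HasDerivWithinAt (fun t => ∫ x in (0 : ℝ)..t, p (max x 0) i) (p t i) (Ici 0) t := by
    intro i t ht
    have := ((hcont i).integral_hasStrictDerivAt 0 t).hasDerivAt.hasDerivWithinAt (s := Ici 0)
    simpa [max_eq_left ht] using this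
  have key := eq_of_hasDerivWithinAt_zero
    (f := fun t => ℓ e * Real.log (σ t e) - ((∫ x in (0 : ℝ)..t, p (max x 0) (tail e))
      - ∫ x in (0 : ℝ)..t, p (max x 0) (head e)) + ℓ e * t)
    (fun t ht => by
      refine ((((h.hasDerivWithinAt_log ht e).const_mul (ℓ e)).sub
        ((hP (tail e) t ht).sub (hP (head e) t ht))).add
        ((hasDerivWithinAt_id t (Ici 0)).const_mul (ℓ e))).congr_deriv ?_
      have := (hℓ e).ne'
      simp only [field]
      field_simp
      ring) ht
  simp only [intervalIntegral.integral_same] at key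
  linarith

/-- Arcs of the optimal support stay bounded away from zero, via the Lyapunov function
`∑ ℓ φ log σ - 2 cost σ`. -/
theorem exists_le_log (hloops : NoLoops tail head) (hℓ : ∀ e, 0 < ℓ e)
    (h : PhysarumDynamics tail head ℓ b σ p) {φ : E → ℝ} (hφ : IsFlow tail head b φ)
    (hφ0 : ∀ e, 0 ≤ φ e) {x : V → ℝ} {s : E → ℝ}
    (hx : ∀ e, ℓ e = x (tail e) - x (head e) + s e) (hs : ∀ e, 0 ≤ s e)
    (hsφ : ∀ e, s e * φ e = 0) :
    ∃ m, ∀ t, 0 ≤ t → ∀ e, 0 < φ e → m ≤ ℓ e * φ e * Real.log (σ t e) := by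
  obtain ⟨M, hM1, hM⟩ := h.exists_le hloops hℓ
  set κ := ∑ i, x i * ((incMatrix tail head).mulVec (σ 0) i - b i) with hκ
  have hxb : ∑ i, x i * b i = cost ℓ φ := by
    rw [← hφ, sum_mul_incMatrix_mulVec hloops]
    refine Finset.sum_congr rfl fun e _ => ?_
    rw [hx e, add_mul, hsφ, add_zero]
  have hgap : ∀ t, 0 ≤ t → cost ℓ φ + Real.exp (-t) * κ ≤ cost ℓ (σ t) := by
    intro t ht
    have h1 := sum_mul_incMatrix_mulVec hloops x (σ t)
    simp only [h.incMatrix_mulVec hloops ht, mul_add, Finset.sum_add_distrib, hxb] at h1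
    have h2 : ∑ i, x i * (Real.exp (-t) * ((incMatrix tail head).mulVec (σ 0) i - b i))
        = Real.exp (-t) * κ := by
      rw [hκ, Finset.mul_sum]
      exact Finset.sum_congr rfl fun i _ => by ring
    rw [h2] at h1
    rw [h1]
    refine Finset.sum_le_sum fun e _ => ?_
    have := mul_nonneg (hs e) (h.pos t ht e).le
    rw [hx e]
    linarith
  have hderiv : ∀ t, 0 ≤ t → HasDerivWithinAt
      (fun t => ∑ e, (ℓ e * φ e * Real.log (σ t e) - 2 * (ℓ e * σ t e)) + Real.exp (-t) * κ)
      (∑ e, (ℓ e * φ e * (field tail head ℓ (p t) e - 1)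
        - 2 * (ℓ e * (current tail head ℓ σ p t e - σ t e))) + Real.exp (-t) * (-1) * κ)
      (Ici 0) t := by
    intro t ht
    refine HasDerivWithinAt.add (HasDerivWithinAt.fun_sum fun e _ => ?_) ?_
    · exact ((h.hasDerivWithinAt_log ht e).const_mul _).sub
        (((h.dyn t ht e).const_mul _).const_mul _)
    · exact ((hasDerivAt_neg t).exp.mul_const κ).hasDerivWithinAt
  have hnonneg : ∀ t, 0 ≤ t → 0 ≤ ∑ e, (ℓ e * φ e * (field tail head ℓ (p t) e - 1)
        - 2 * (ℓ e * (current tail head ℓ σ p t e - σ t e))) + Real.exp (-t) * (-1) * κ := by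
    intro t ht
    have hE : ∑ e, ℓ e * φ e * field tail head ℓ (p t) e
        = ∑ e, ℓ e * current tail head ℓ σ p t e * field tail head ℓ (p t) e := by
      have h1 := sum_mul_incMatrix_mulVec hloops (p t) φ
      have h2 := sum_mul_incMatrix_mulVec hloops (p t) (current tail head ℓ σ p t)
      rw [h.incMatrix_mulVec_current hloops ht] at h2
      rw [hφ, h2] at h1
      have : ∀ ψ : E → ℝ, ∑ e, ℓ e * ψ e * field tail head ℓ (p t) e
          = ∑ e, (p t (tail e) - p t (head e)) * ψ e := by
        intro ψ
        refine Finset.sum_congr rfl fun e _ => ?_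
        have := (hℓ e).ne'
        simp only [field]
        field_simp
      rw [this, this, h1]
    have hsum : ∑ e, (ℓ e * φ e * (field tail head ℓ (p t) e - 1)
        - 2 * (ℓ e * (current tail head ℓ σ p t e - σ t e)))
        = ∑ e, ℓ e * σ t e * (field tail head ℓ (p t) e - 1) ^ 2 + cost ℓ (σ t) - cost ℓ φ := by
      have h1 : ∑ e, (ℓ e * φ e * (field tail head ℓ (p t) e - 1)
          - 2 * (ℓ e * (current tail head ℓ σ p t e - σ t e)))
          = ∑ e, ℓ e * φ e * field tail head ℓ (p t) e - cost ℓ φ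
            - ∑ e, 2 * (ℓ e * (current tail head ℓ σ p t e - σ t e)) := by
        simp only [cost, ← Finset.sum_sub_distrib]
        exact Finset.sum_congr rfl fun e _ => by ring
      rw [h1, hE]
      have h2 : ∑ e, ℓ e * current tail head ℓ σ p t e * field tail head ℓ (p t) e
          - ∑ e, 2 * (ℓ e * (current tail head ℓ σ p t e - σ t e))
          = ∑ e, ℓ e * σ t e * (field tail head ℓ (p t) e - 1) ^ 2 + cost ℓ (σ t) := by
        simp only [cost, ← Finset.sum_sub_distrib, ← Finset.sum_add_distrib, current]
        exact Finset.sum_congr rfl fun e _ => by ring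
      linarith
    rw [hsum]
    have h1 : 0 ≤ ∑ e, ℓ e * σ t e * (field tail head ℓ (p t) e - 1) ^ 2 :=
      Finset.sum_nonneg fun e _ =>
        mul_nonneg (mul_nonneg (hℓ e).le (h.pos t ht e).le) (sq_nonneg _)
    have h2 := hgap t ht
    linarith
  set W₀ := ∑ e, (ℓ e * φ e * Real.log (σ 0 e) - 2 * (ℓ e * σ 0 e)) + Real.exp (-0) * κ
  refine ⟨W₀ - |κ| - ∑ e, ℓ e * φ e * Real.log M, fun t ht e he => ?_⟩
  have key : W₀ ≤ _ := le_of_hasDerivWithinAt_nonneg hderiv hnonneg ht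
  have hκ' : Real.exp (-t) * κ ≤ |κ| := by
    have h1 : Real.exp (-t) ≤ 1 := Real.exp_le_one_iff.2 (by linarith)
    calc Real.exp (-t) * κ ≤ Real.exp (-t) * |κ| :=
          mul_le_mul_of_nonneg_left (le_abs_self κ) (Real.exp_pos _).le
      _ ≤ 1 * |κ| := mul_le_mul_of_nonneg_right h1 (abs_nonneg κ)
      _ = |κ| := one_mul _
  have hlogM : 0 ≤ Real.log M := Real.log_nonneg hM1
  have hterm : ∀ f, ℓ f * φ f * Real.log (σ t f) - 2 * (ℓ f * σ t f)
      ≤ ℓ f * φ f * Real.log M := by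
    intro f
    have h1 : Real.log (σ t f) ≤ Real.log M := Real.log_le_log (h.pos t ht f) (hM t ht f)
    have h2 := mul_le_mul_of_nonneg_left h1 (mul_nonneg (hℓ f).le (hφ0 f))
    have h3 := mul_nonneg (hℓ f).le (h.pos t ht f).le
    linarith
  have hsplit : ∑ f, (ℓ f * φ f * Real.log (σ t f) - 2 * (ℓ f * σ t f))
      ≤ ℓ e * φ e * Real.log (σ t e) + ∑ f, ℓ f * φ f * Real.log M := by
    rw [← Finset.add_sum_erase _ _ (Finset.mem_univ e)]
    have h1 : ∑ f ∈ Finset.univ.erase e,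
        (ℓ f * φ f * Real.log (σ t f) - 2 * (ℓ f * σ t f))
        ≤ ∑ f, ℓ f * φ f * Real.log M := by
      refine (Finset.sum_le_sum fun f _ => hterm f).trans ?_
      exact Finset.sum_le_sum_of_subset_of_nonneg (Finset.erase_subset _ _)
        fun f _ _ => mul_nonneg (mul_nonneg (hℓ f).le (hφ0 f)) hlogM
    have h2 := mul_nonneg (hℓ e).le (h.pos t ht e).le
    linarith
  linarith

end PhysarumDynamics

end PhysarumDecay

theorem statement_11 {V E : Type*} [Fintype V] [Fintype E] [DecidableEq V] [DecidableEq E]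
    (tail head : E → V)
    (hloops : NoLoops tail head) (hmult : NoMultiple tail head)
    (hconn : IsConnectedGraph tail head)
    (ℓ : E → ℝ) (hℓ : ∀ e, 0 < ℓ e)
    (b : V → ℝ) (hb : ∑ i, b i = 0)
    (hfeas : Feasible tail head b)
    (σ : ℝ → E → ℝ) (p : ℝ → V → ℝ)
    (hdyn : PhysarumDynamics tail head ℓ b σ p) :
    ∃ C > (0:ℝ), ∃ a > (0:ℝ), ∀ t : ℝ, 0 ≤ t →
      ∀ e : E, e ∉ optSupport tail head ℓ b → σ t e ≤ C * Real.exp (-a * t) := by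
  obtain ⟨φ, hφ, hφpos⟩ := exists_isOptimal_pos_on_optSupport hℓ hfeas
  obtain ⟨x, s, hx, hs0, hspos⟩ := exists_strict_dual hloops hφ hφpos
  have hs : ∀ e, 0 ≤ s e := fun e => by
    by_cases he : e ∈ optSupport tail head ℓ b
    · exact (hs0 e he).ge
    · exact (hspos e he).le
  have hφH : ∀ e, φ e ≠ 0 → e ∈ optSupport tail head ℓ b := fun e he =>
    ⟨φ, hφ, lt_of_le_of_ne (hφ.2.1 e) (Ne.symm he)⟩
  have hsφ : ∀ e, s e * φ e = 0 := fun e => by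
    by_cases he : φ e = 0
    · rw [he, mul_zero]
    · rw [hs0 e (hφH e he), zero_mul]
  obtain ⟨A, hA1, hA⟩ := hdyn.exists_le hloops hℓ
  have hA0 : 0 < A := one_pos.trans_le hA1
  obtain ⟨P, hP⟩ := hdyn.exists_potential hℓ
  obtain ⟨m, hm⟩ := hdyn.exists_le_log hloops hℓ hφ.1 hφ.2.1 hx hs hsφ
  -- The potential relative to the dual solution.
  let q : ℝ → V → ℝ := fun t i => P t i - t * x i
  have hq : ∀ t, 0 ≤ t → ∀ e, ℓ e * (Real.log (σ t e) - Real.log (σ 0 e))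
      = q t (tail e) - q t (head e) - s e * t := by
    intro t ht e
    rw [hP t ht e]
    have h1 := hx e
    simp only [q]
    rw [h1]
    ring
  have hexp : ∀ t, 0 ≤ t → ∀ e,
      σ t e ≤ A * Real.exp ((q t (tail e) - q t (head e) - s e * t) / ℓ e) := by
    intro t ht e
    have h1 : Real.log (σ t e) - Real.log (σ 0 e)
        = (q t (tail e) - q t (head e) - s e * t) / ℓ e := by
      rw [← hq t ht e, mul_div_cancel_left₀ _ (hℓ e).ne']
    rw [← h1, Real.exp_sub, Real.exp_log (hdyn.pos t ht e),
      Real.exp_log (hdyn.pos 0 le_rfl e), mul_div_assoc']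
    rw [le_div_iff₀ (hdyn.pos 0 le_rfl e), mul_comm]
    exact mul_le_mul_of_nonneg_right (hA 0 le_rfl e) (hdyn.pos t ht e).le
  obtain ⟨L, hL0, hL⟩ : ∃ L > 0, ∀ e, ℓ e ≤ L := by
    obtain ⟨L, hL⟩ := (Set.finite_range ℓ).bddAbove
    exact ⟨max L 1, by positivity, fun e => (hL ⟨e, rfl⟩).trans (le_max_left _ _)⟩
  obtain ⟨δ, hδ0, hδ⟩ : ∃ δ > 0, ∀ e, e ∉ optSupport tail head ℓ b → δ ≤ s e := by
    have : ∀ᶠ δ in 𝓝[>] (0 : ℝ), ∀ e, e ∉ optSupport tail head ℓ b → δ ≤ s e := by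
      rw [eventually_all]
      intro e
      by_cases he : e ∈ optSupport tail head ℓ b
      · exact Eventually.of_forall fun _ h => absurd he h
      · filter_upwards [nhdsWithin_le_nhds (gt_mem_nhds (hspos e he))] with δ h _ using h.le
    obtain ⟨δ, h, h0⟩ := (this.and self_mem_nhdsWithin).exists
    exact ⟨δ, h0, h⟩
  obtain ⟨M, hM0, hM⟩ : ∃ M > 0, ∀ t, 0 ≤ t → ∀ e, φ e ≠ 0 →
      |q t (tail e) - q t (head e)| < M := by
    have : ∀ e, ∃ M, ∀ t, 0 ≤ t → φ e ≠ 0 → |q t (tail e) - q t (head e)| ≤ M := by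
      intro e
      refine ⟨max (ℓ e * (Real.log A - Real.log (σ 0 e)))
        (-(m / φ e - ℓ e * Real.log (σ 0 e))), fun t ht he => ?_⟩
      have hpos := lt_of_le_of_ne (hφ.2.1 e) (Ne.symm he)
      have h1 := hq t ht e
      rw [hs0 e (hφH e he), zero_mul, sub_zero] at h1
      rw [← h1, abs_le]
      constructor
      · have h2 : m / φ e ≤ ℓ e * Real.log (σ t e) := by
          rw [div_le_iff₀ hpos]
          linarith [hm t ht e hpos]
        have h3 := le_max_right (ℓ e * (Real.log A - Real.log (σ 0 e)))
          (-(m / φ e - ℓ e * Real.log (σ 0 e)))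
        linarith
      · refine le_trans ?_ (le_max_left _ _)
        exact mul_le_mul_of_nonneg_left (sub_le_sub_right
          (Real.log_le_log (hdyn.pos t ht e) (hA t ht e)) _) (hℓ e).le
    choose Me hMe using this
    obtain ⟨M, hM⟩ := (Set.finite_range Me).bddAbove
    refine ⟨max M 0 + 1, by positivity, fun t ht e he => ?_⟩
    calc _ ≤ Me e := hMe e t ht he
      _ ≤ max M 0 := (hM ⟨e, rfl⟩).trans (le_max_left _ _)
      _ < _ := lt_add_one _
  set n : ℝ := Fintype.card V + 1 with hn
  have hn1 : 1 ≤ n := by rw [hn]; linarith [(Fintype.card V).cast_nonneg (α := ℝ)]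
  have hn0 : 0 < n := one_pos.trans_le hn1
  set K := ∑ i, |(incMatrix tail head).mulVec (σ 0) i - b i| with hK
  have hK0 : 0 ≤ K := Finset.sum_nonneg fun _ _ => abs_nonneg _
  set r := δ / (2 * n * L) with hr
  have hr0 : 0 < r := by positivity
  set a := min 1 r with ha
  have ha0 : 0 < a := lt_min one_pos hr0
  set T := 2 * n * M / δ with hT
  have hrate : ∀ t, 0 ≤ t → Real.exp (-r * t) ≤ Real.exp (-a * t) := fun t ht =>
    Real.exp_le_exp.2 (mul_le_mul_of_nonneg_right (neg_le_neg (min_le_right _ _)) ht)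
  refine ⟨A + A * Real.exp (a * T) + (K + Fintype.card E * A), by positivity, a, ha0,
    fun t ht e he => ?_⟩
  have hN : (0 : ℝ) ≤ K + Fintype.card E * A := by positivity
  set X := Real.exp (-a * t) with hX
  have hX0 : 0 < X := Real.exp_pos _
  have hT1 : 0 ≤ A * Real.exp (a * T) * X := by positivity
  have hA1 : 0 ≤ A * X := by positivity
  have hN1 := mul_nonneg hN hX0.le
  rw [add_mul, add_mul]
  set d := q t (tail e) - q t (head e) with hd
  rcases le_or_gt d (δ * t / 2) with hsmall | hlarge
  · have h1 : (d - s e * t) / ℓ e ≤ -r * t := by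
      rw [div_le_iff₀ (hℓ e)]
      have h2 := mul_le_mul_of_nonneg_right (hδ e he) ht
      have h3 : r * t * ℓ e ≤ δ * t / 2 := by
        calc r * t * ℓ e ≤ r * t * L := mul_le_mul_of_nonneg_left (hL e) (by positivity)
          _ = δ * t / 2 / n := by rw [hr]; field_simp
          _ ≤ δ * t / 2 := div_le_self (by positivity) hn1
      linarith
    have h2 : σ t e ≤ A * X := (hexp t ht e).trans
      (mul_le_mul_of_nonneg_left ((Real.exp_le_exp.2 h1).trans (hrate t ht)) hA0.le)
    linarith
  have hwt : δ * t / (2 * n) ≤ d / n := by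
    rw [div_le_div_iff₀ (by positivity) hn0]
    nlinarith
  rcases le_or_gt (d / n) M with hwM | hwM
  · have h1 : t ≤ T := by
      rw [hT, le_div_iff₀ hδ0]
      have := hwt.trans hwM
      rw [div_le_iff₀ (by positivity)] at this
      linarith
    have h2 : 1 ≤ Real.exp (a * T) * X := by
      rw [hX, ← Real.exp_add]
      refine Real.one_le_exp ?_
      nlinarith
    have h3 := mul_le_mul_of_nonneg_left h2 hA0.le
    have h4 := hA t ht e
    rw [mul_one, ← mul_assoc] at h3
    linarith
  · have hw0 : 0 < d / n := hM0.trans hwM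
    have key := le_of_large_drop hloops hφ.1 (fun f => (hdyn.pos t ht f).le) (q := q t)
      (w := d / n) (η := A * Real.exp (-r * t)) hw0 (by positivity)
      (fun f hf => (hM t ht f hf).trans hwM) (fun f hf => ?_) (e := e)
      (by rw [← hn, mul_div_cancel₀ _ hn0.ne'])
    · have h1 : ∑ i, |(incMatrix tail head).mulVec (σ t) i - b i| = Real.exp (-t) * K := by
        rw [hK, Finset.mul_sum]
        refine Finset.sum_congr rfl fun i _ => ?_
        rw [hdyn.incMatrix_mulVec hloops ht, add_sub_cancel_left, abs_mul, Real.abs_exp]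
      rw [h1] at key
      have h2 : Real.exp (-t) ≤ X := Real.exp_le_exp.2 (by
        have := mul_le_mul_of_nonneg_right (min_le_left 1 r) ht
        linarith)
      have h3 := mul_le_mul_of_nonneg_right h2 hK0
      have h4 := mul_le_mul_of_nonneg_left (hrate t ht)
        (by positivity : (0 : ℝ) ≤ Fintype.card E * A)
      linarith
    · refine (hexp t ht f).trans (mul_le_mul_of_nonneg_left (Real.exp_le_exp.2 ?_) hA0.le)
      rw [div_le_iff₀ (hℓ f)]
      have h1 : r * t * ℓ f ≤ δ * t / (2 * n) := by
        calc r * t * ℓ f ≤ r * t * L := mul_le_mul_of_nonneg_left (hL f) (by positivity)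
          _ = δ * t / (2 * n) := by rw [hr]; field_simp
      have h2 := mul_nonneg (hs f) ht
      linarith
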